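/- arXiv:1312.3176 — 2 statements merged into one kernel-verified Lean document; each statement's English description precedes it below -/
import Mathlib

section
/- The potential V has no stationary point in the exterior of T: for every point P ∉ T one has gradient V P ≠ 0. -/
open MeasureTheory

theorem continuousOn_inv_dist {X : Type*} [MetricSpace X] {K : Set X} {x : X} (hx : x ∉ K) :
    ContinuousOn (fun q => (dist x q)⁻¹) K :=
  ContinuousOn.inv₀ (by fun_prop) fun q hq => dist_ne_zero.mpr fun h => hx (h ▸ hq)

section InverseDistance

variable {E : Type*} [NormedAddCommGroup E] [InnerProductSpace ℝ E]

/-- The derivative of `x ↦ (dist x q)⁻¹` at `x ≠ q`. -/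
noncomputable def invDistFDeriv (x q : E) : E →L[ℝ] ℝ :=
  (‖x - q‖ ^ 3)⁻¹ • innerSL ℝ (q - x)

theorem hasFDerivAt_inv_dist {x q : E} (h : x ≠ q) :
    HasFDerivAt (fun y => (dist y q)⁻¹) (invDistFDeriv x q) x := by
  have hr : ‖x - q‖ ≠ 0 := norm_ne_zero_iff.mpr (sub_ne_zero.mpr h)
  have h₁ := (((hasFDerivAt_id x).sub_const q).norm_sq).sqrt (pow_ne_zero 2 hr)
  have h₂ := (hasDerivAt_inv (by simpa using hr)).comp_hasFDerivAt x h₁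
  convert! h₂ using 1
  · ext y
    simp [dist_eq_norm]
  · ext v
    simp only [invDistFDeriv, smul_apply, innerSL_apply_apply, id_eq,
      norm_nonneg, Real.sqrt_sq, smul_eq_mul, nsmul_eq_mul, ContinuousLinearMap.comp_apply,
      ContinuousLinearMap.id_apply, ← neg_sub x q, inner_neg_left]
    field_simp
    simp

theorem norm_invDistFDeriv (x q : E) : ‖invDistFDeriv x q‖ = (‖x - q‖ ^ 2)⁻¹ := by
  rcases eq_or_ne ‖x - q‖ 0 with hr | hr
  · simp [invDistFDeriv, hr]
  · rw [invDistFDeriv, norm_smul, innerSL_apply_norm, norm_sub_rev q x]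
    simp only [norm_inv, norm_pow, norm_norm]
    field_simp

theorem continuousOn_invDistFDeriv {K : Set E} {x : E} (hx : x ∉ K) :
    ContinuousOn (invDistFDeriv x) K := by
  have hinner : ContinuousOn (fun q => innerSL ℝ (q - x)) K := by fun_prop
  refine ContinuousOn.smul (ContinuousOn.inv₀ (f := fun q => ‖x - q‖ ^ 3) (by fun_prop)
    fun q hq => ?_) hinner
  exact pow_ne_zero 3 (norm_ne_zero_iff.mpr (sub_ne_zero.mpr fun h => hx (h ▸ hq)))

variable [MeasurableSpace E] [BorelSpace E] {μ : Measure E} [IsFiniteMeasureOnCompacts μ]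

/-- Off a compact set, its potential may be differentiated under the integral sign. -/
theorem hasFDerivAt_potential {K : Set E} (hK : IsCompact K) {x : E} (hx : x ∉ K) :
    HasFDerivAt (fun y => ∫ q in K, (dist y q)⁻¹ ∂μ) (∫ q in K, invDistFDeriv x q ∂μ) x := by
  have hm : MeasurableSet K := hK.measurableSet
  obtain ⟨δ, hδ, hball⟩ := Metric.isOpen_iff.mp hK.isClosed.isOpen_compl x hx
  have hsep : ∀ y ∈ Metric.ball x (δ / 2), ∀ q ∈ K, δ / 2 ≤ ‖y - q‖ := by
    intro y hy q hq
    have hxq : δ ≤ dist q x := not_lt.mp fun h => hball h hq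
    have := dist_triangle q y x
    rw [Metric.mem_ball] at hy
    rw [← dist_eq_norm, dist_comm]
    linarith
  refine hasFDerivAt_integral_of_dominated_of_fderiv_le (s := Metric.ball x (δ / 2))
    (bound := fun _ => ((δ / 2) ^ 2)⁻¹) (Metric.ball_mem_nhds x (half_pos hδ)) ?_ ?_ ?_ ?_ ?_ ?_
  · filter_upwards [hK.isClosed.isOpen_compl.mem_nhds hx] with y hy
    exact ((continuousOn_inv_dist hy).integrableOn_compact hK).aestronglyMeasurable
  · exact (continuousOn_inv_dist hx).integrableOn_compact hK
  · exact ((continuousOn_invDistFDeriv hx).integrableOn_compact hK).aestronglyMeasurable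
  · filter_upwards [ae_restrict_mem hm] with q hq y hy
    rw [norm_invDistFDeriv]
    have := hsep y hy q hq
    gcongr
  · exact continuousOn_const.integrableOn_compact hK
  · filter_upwards [ae_restrict_mem hm] with q hq y hy
    refine hasFDerivAt_inv_dist fun h => ?_
    have := hsep y hy q hq
    rw [h, sub_self, norm_zero] at this
    linarith

/-- The potential of a compact convex set of positive measure has no stationary point off it. -/
theorem gradient_potential_ne_zero [CompleteSpace E] {K : Set E} (hK : IsCompact K)
    (hconv : Convex ℝ K) (hpos : 0 < μ K) {x : E} (hx : x ∉ K) :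
    gradient (fun y => ∫ q in K, (dist y q)⁻¹ ∂μ) x ≠ 0 := by
  obtain ⟨f, c, hfx, hfK⟩ := geometric_hahn_banach_point_closed hconv hK.isClosed hx
  set u := (InnerProductSpace.toDual ℝ E).symm f
  have hderiv := hasFDerivAt_potential (μ := μ) hK hx
  have hint : IntegrableOn (invDistFDeriv x) K μ :=
    (continuousOn_invDistFDeriv hx).integrableOn_compact hK
  have hposu : ∀ q ∈ K, 0 < invDistFDeriv x q u := by
    intro q hq
    have hxq : x ≠ q := fun h => hx (h ▸ hq)
    have hr : 0 < ‖x - q‖ := norm_pos_iff.mpr (sub_ne_zero.mpr hxq)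
    have hf : inner ℝ (q - x) u = f q - f x := by
      rw [real_inner_comm, InnerProductSpace.toDual_symm_apply, map_sub]
    have := hfK q hq
    rw [invDistFDeriv, smul_apply, innerSL_apply_apply, hf, smul_eq_mul]
    exact mul_pos (by positivity) (by linarith)
  have hlt : 0 < ∫ q in K, invDistFDeriv x q u ∂μ := by
    rw [setIntegral_pos_iff_support_of_nonneg_ae _ (hint.apply_continuousLinearMap u)]
    · exact hpos.trans_le (measure_mono fun q hq => ⟨(hposu q hq).ne', hq⟩)
    · filter_upwards [ae_restrict_mem hK.measurableSet] with q hq using (hposu q hq).le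
  intro hgrad
  rw [← ContinuousLinearMap.integral_apply hint, ← hderiv.fderiv] at hlt
  rw [gradient, map_eq_zero_iff _ (LinearIsometryEquiv.injective _)] at hgrad
  simp [hgrad] at hlt

end InverseDistance

theorem AffineIndependent.interior_convexHull_triple_nonempty {E : Type*} [NormedAddCommGroup E]
    [NormedSpace ℝ E] [FiniteDimensional ℝ E] (hE : Module.finrank ℝ E = 2) {a b c : E}
    (h : AffineIndependent ℝ ![a, b, c]) : (interior (convexHull ℝ {a, b, c})).Nonempty := by
  have hspan := h.affineSpan_eq_top_iff_card_eq_finrank_add_one.mpr (by simp [hE])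
  rw [interior_convexHull_nonempty_iff_affineSpan_eq_top, ← hspan]
  congr 1
  simp only [Matrix.range_cons, Matrix.range_empty, Set.union_empty, Set.insert_eq]

theorem potential_no_stationary_point_exterior
    (A B C : EuclideanSpace ℝ (Fin 2))
    (hABC : AffineIndependent ℝ ![A, B, C])
    (T : Set (EuclideanSpace ℝ (Fin 2)))
    (hT : T = convexHull ℝ {A, B, C})
    (V : EuclideanSpace ℝ (Fin 2) → ℝ)
    (hV : ∀ P, V P = ∫ Q in T, (dist P Q)⁻¹ ∂volume)
    (P : EuclideanSpace ℝ (Fin 2)) (hP : P ∉ T) :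
    gradient V P ≠ 0 := by
  obtain rfl : V = fun P => ∫ Q in T, (dist P Q)⁻¹ ∂volume := funext hV
  subst hT
  exact gradient_potential_ne_zero ((Set.toFinite _).isCompact_convexHull ℝ) (convex_convexHull ℝ _)
    (Measure.measure_pos_of_nonempty_interior _
      (hABC.interior_convexHull_triple_nonempty (by simp))) hP
end

section
/- Existence and uniqueness of the parameter: let a, b, c be positive real numbers satisfying the strict triangle inequalities a < b + c, b < c + a, c < a + b. With u(λ), v(λ), w(λ), F(λ) as defined below, there exists a unique λ > 0 such that F(λ) = Real.sqrt(2·(a²b² + b²c² + c²a²) − (a⁴ + b⁴ + c⁴)). -/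
open Real Set Filter Topology

/-- The function `t ↦ x * coth (x * t)`. -/
noncomputable def scaledCoth (x t : ℝ) : ℝ := x * (cosh (x * t) / sinh (x * t))

theorem hasDerivAt_sinh_mul (x t : ℝ) :
    HasDerivAt (fun t => sinh (x * t)) (x * cosh (x * t)) t := by
  have h := ((hasDerivAt_id t).const_mul x).sinh
  simpa [mul_comm] using h

theorem hasDerivAt_cosh_mul (x t : ℝ) :
    HasDerivAt (fun t => cosh (x * t)) (x * sinh (x * t)) t := by
  have h := ((hasDerivAt_id t).const_mul x).cosh
  simpa [mul_comm] using h

theorem sinh_mul_pos {x t : ℝ} (hx : 0 < x) (ht : 0 < t) : 0 < sinh (x * t) :=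
  sinh_pos_iff.2 (mul_pos hx ht)

theorem mul_sinh_mul_le {x y t : ℝ} (hy : 0 < y) (hyx : y ≤ x) (ht : 0 < t) :
    x * sinh (y * t) ≤ y * sinh (x * t) := by
  have hx : 0 < x := hy.trans_le hyx
  have hd : ∀ s, HasDerivAt (fun s => y * sinh (x * s) - x * sinh (y * s))
      (y * (x * cosh (x * s)) - x * (y * cosh (y * s))) s := fun s =>
    ((hasDerivAt_sinh_mul x s).const_mul y).sub ((hasDerivAt_sinh_mul y s).const_mul x)
  have hm : MonotoneOn (fun s => y * sinh (x * s) - x * sinh (y * s)) (Ici 0) := by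
    refine monotoneOn_of_deriv_nonneg (convex_Ici 0)
      (fun s _ => (hd s).continuousAt.continuousWithinAt)
      (fun s _ => (hd s).differentiableAt.differentiableWithinAt) fun s hs => ?_
    rw [interior_Ici, mem_Ioi] at hs
    rw [(hd s).deriv]
    have hc : cosh (y * s) ≤ cosh (x * s) := by
      rw [cosh_le_cosh, abs_of_pos (mul_pos hy hs), abs_of_pos (mul_pos hx hs)]
      gcongr
    have := mul_le_mul_of_nonneg_left hc (mul_pos hx hy).le
    linarith
  have := hm self_mem_Ici (mem_Ici.2 ht.le) ht.le
  simp only [mul_zero, sinh_zero, sub_zero] at this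
  linarith

theorem div_sinh_mul_le {x y t : ℝ} (hy : 0 < y) (hyx : y ≤ x) (ht : 0 < t) :
    x / sinh (x * t) ≤ y / sinh (y * t) := by
  rw [div_le_div_iff₀ (sinh_mul_pos (hy.trans_le hyx) ht) (sinh_mul_pos hy ht)]
  exact mul_sinh_mul_le hy hyx ht

theorem scaledCoth_le_scaledCoth {x y t : ℝ} (hy : 0 < y) (hyx : y ≤ x) (ht : 0 < t) :
    scaledCoth y t ≤ scaledCoth x t := by
  have hx : 0 < x := hy.trans_le hyx
  have hd : ∀ s, HasDerivAt
      (fun s => x * (cosh (x * s) * sinh (y * s)) - y * (cosh (y * s) * sinh (x * s)))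
      (x * (x * sinh (x * s) * sinh (y * s) + cosh (x * s) * (y * cosh (y * s)))
        - y * (y * sinh (y * s) * sinh (x * s) + cosh (y * s) * (x * cosh (x * s)))) s := fun s =>
    (((hasDerivAt_cosh_mul x s).mul (hasDerivAt_sinh_mul y s)).const_mul x).sub
      (((hasDerivAt_cosh_mul y s).mul (hasDerivAt_sinh_mul x s)).const_mul y)
  have hm : MonotoneOn
      (fun s => x * (cosh (x * s) * sinh (y * s)) - y * (cosh (y * s) * sinh (x * s)))
      (Ici 0) := by
    refine monotoneOn_of_deriv_nonneg (convex_Ici 0)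
      (fun s _ => (hd s).continuousAt.continuousWithinAt)
      (fun s _ => (hd s).differentiableAt.differentiableWithinAt) fun s hs => ?_
    rw [interior_Ici, mem_Ioi] at hs
    rw [(hd s).deriv]
    have hp := mul_pos (sinh_mul_pos hx hs) (sinh_mul_pos hy hs)
    have hq : 0 ≤ x ^ 2 - y ^ 2 := sub_nonneg.2 (by gcongr)
    have := mul_nonneg hq hp.le
    linarith
  have := hm self_mem_Ici (mem_Ici.2 ht.le) ht.le
  simp only [mul_zero, sinh_zero, sub_zero] at this
  unfold scaledCoth
  rw [← mul_div_assoc, ← mul_div_assoc,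
    div_le_div_iff₀ (sinh_mul_pos hy ht) (sinh_mul_pos hx ht)]
  linarith

theorem scaledCoth_sub_le {x y t : ℝ} (hy : 0 < y) (hyx : y ≤ x) (ht : 0 < t) :
    scaledCoth x t - scaledCoth y t ≤ x - y := by
  have key : ∀ z, 0 < z → scaledCoth z t - z = z / sinh (z * t) * exp (-(z * t)) := by
    intro z hz
    have := (sinh_mul_pos hz ht).ne'
    rw [← cosh_sub_sinh, scaledCoth]
    field_simp
  have h : x / sinh (x * t) * exp (-(x * t)) ≤ y / sinh (y * t) * exp (-(y * t)) := by
    have := sinh_mul_pos hy ht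
    apply mul_le_mul (div_sinh_mul_le hy hyx ht) _ (exp_pos _).le (by positivity)
    gcongr
  rw [← key x (hy.trans_le hyx), ← key y hy] at h
  linarith

theorem hasDerivAt_scaledCoth {x t : ℝ} (hx : 0 < x) (ht : 0 < t) :
    HasDerivAt (scaledCoth x) (-(x / sinh (x * t)) ^ 2) t := by
  have hs := (sinh_mul_pos hx ht).ne'
  refine (((hasDerivAt_cosh_mul x t).div (hasDerivAt_sinh_mul x t) hs).const_mul x).congr_deriv ?_
  rw [div_pow, ← mul_div_assoc, ← neg_div]
  congr 1
  linear_combination (-x ^ 2) * cosh_sq (x * t)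

theorem scaledCoth_sub_monotoneOn {x y : ℝ} (hy : 0 < y) (hyx : y ≤ x) :
    MonotoneOn (fun t => scaledCoth x t - scaledCoth y t) (Ioi 0) := by
  have hx : 0 < x := hy.trans_le hyx
  have hd : ∀ t ∈ Ioi (0 : ℝ), HasDerivAt (fun t => scaledCoth x t - scaledCoth y t)
      (-(x / sinh (x * t)) ^ 2 - -(y / sinh (y * t)) ^ 2) t := fun t ht =>
    (hasDerivAt_scaledCoth hx ht).sub (hasDerivAt_scaledCoth hy ht)
  refine monotoneOn_of_deriv_nonneg (convex_Ioi 0)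
    (fun t ht => (hd t ht).continuousAt.continuousWithinAt)
    (fun t ht => (hd t (interior_subset ht)).differentiableAt.differentiableWithinAt)
    fun t ht => ?_
  rw [interior_Ioi] at ht
  rw [(hd t ht).deriv]
  have := sinh_mul_pos hx ht
  have : (x / sinh (x * t)) ^ 2 ≤ (y / sinh (y * t)) ^ 2 := by
    have := div_sinh_mul_le hy hyx ht
    gcongr
  linarith

theorem scaledCoth_sub_sq_monotoneOn {x y : ℝ} (hx : 0 < x) (hy : 0 < y) :
    MonotoneOn (fun t => (scaledCoth x t - scaledCoth y t) ^ 2) (Ioi 0) := by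
  wlog hyx : y ≤ x generalizing x y
  · simpa only [sub_sq_comm] using this hy hx (le_of_not_ge hyx)
  intro s hs t ht hst
  exact pow_le_pow_left₀ (sub_nonneg.2 (scaledCoth_le_scaledCoth hy hyx hs))
    (scaledCoth_sub_monotoneOn hy hyx hs ht hst) 2

theorem scaledCoth_sub_sq_le {x y t : ℝ} (hx : 0 < x) (hy : 0 < y) (ht : 0 < t) :
    (scaledCoth x t - scaledCoth y t) ^ 2 ≤ (x - y) ^ 2 := by
  wlog hyx : y ≤ x generalizing x y
  · simpa only [sub_sq_comm] using this hy hx (le_of_not_ge hyx)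
  exact pow_le_pow_left₀ (sub_nonneg.2 (scaledCoth_le_scaledCoth hy hyx ht))
    (scaledCoth_sub_le hy hyx ht) 2

theorem scaledCoth_sq_sub_sq {x t : ℝ} (hx : 0 < x) (ht : 0 < t) :
    scaledCoth x t ^ 2 - x ^ 2 = (x / sinh (x * t)) ^ 2 := by
  have := (sinh_mul_pos hx ht).ne'
  rw [scaledCoth]
  field_simp
  linear_combination cosh_sq (x * t)

theorem tendsto_scaledCoth_atTop {x : ℝ} (hx : 0 < x) :
    Tendsto (scaledCoth x) atTop (𝓝 x) := by
  have hxt : Tendsto (fun t : ℝ => x * t) atTop atTop := tendsto_id.const_mul_atTop hx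
  have hsinh : Tendsto (fun t : ℝ => sinh (x * t)) atTop atTop := by
    refine tendsto_atTop_mono' _ ?_ hxt
    filter_upwards [eventually_gt_atTop 0] with t ht
    exact self_le_sinh_iff.2 (mul_pos hx ht).le
  have h := (((tendsto_exp_neg_atTop_nhds_zero.comp hxt).div_atTop hsinh).const_add 1).const_mul x
  simp only [add_zero, mul_one] at h
  refine h.congr' ?_
  filter_upwards [eventually_gt_atTop 0] with t ht
  have := (sinh_mul_pos hx ht).ne'
  rw [scaledCoth, Function.comp_apply, ← cosh_sub_sinh]
  field_simp
  ring

/-- One of the three symmetric summands of `F`, as a function of the rescaled parameter. -/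
noncomputable def areaTerm (x y z t : ℝ) : ℝ :=
  √((scaledCoth x t ^ 2 - x ^ 2) * (x ^ 2 - (scaledCoth y t - scaledCoth z t) ^ 2))

section areaTerm

variable {x y z : ℝ}

theorem sq_sub_scaledCoth_sub_sq_pos (hy : 0 < y) (hz : 0 < z)
    (h : |y - z| < x) {t : ℝ} (ht : 0 < t) :
    0 < x ^ 2 - (scaledCoth y t - scaledCoth z t) ^ 2 := by
  have h1 := scaledCoth_sub_sq_le hy hz ht
  have h2 : (y - z) ^ 2 < x ^ 2 := by
    rw [← sq_abs (y - z)]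
    gcongr
  linarith

theorem areaTerm_strictAntiOn (hx : 0 < x) (hy : 0 < y) (hz : 0 < z) (h : |y - z| < x) :
    StrictAntiOn (areaTerm x y z) (Ioi 0) := by
  intro s hs t ht hst
  rw [mem_Ioi] at hs ht
  have hps := sinh_mul_pos hx hs
  have hpt := sinh_mul_pos hx ht
  apply sqrt_lt_sqrt
  · rw [scaledCoth_sq_sub_sq hx ht]
    exact mul_nonneg (sq_nonneg _) (sq_sub_scaledCoth_sub_sq_pos hy hz h ht).le
  rw [scaledCoth_sq_sub_sq hx ht, scaledCoth_sq_sub_sq hx hs]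
  refine mul_lt_mul ?_ ?_ (sq_sub_scaledCoth_sub_sq_pos hy hz h ht) (sq_nonneg _)
  · have : sinh (x * s) < sinh (x * t) := sinh_lt_sinh.2 (by gcongr)
    gcongr
  · exact sub_le_sub_left (scaledCoth_sub_sq_monotoneOn hy hz hs ht hst.le) _

theorem continuousOn_areaTerm (hx : 0 < x) (hy : 0 < y) (hz : 0 < z) :
    ContinuousOn (areaTerm x y z) (Ioi 0) := by
  have hc : ∀ r, 0 < r → ContinuousOn (scaledCoth r) (Ioi 0) := fun r hr t ht =>
    (hasDerivAt_scaledCoth hr ht).continuousAt.continuousWithinAt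
  exact ((((hc x hx).pow 2).sub continuousOn_const).mul
    (continuousOn_const.sub (((hc y hy).sub (hc z hz)).pow 2))).sqrt

theorem tendsto_areaTerm_atTop (hx : 0 < x) (hy : 0 < y) (hz : 0 < z) :
    Tendsto (areaTerm x y z) atTop (𝓝 0) := by
  have h := ((((tendsto_scaledCoth_atTop hx).pow 2).sub_const (x ^ 2)).mul
    ((((tendsto_scaledCoth_atTop hy).sub (tendsto_scaledCoth_atTop hz)).pow 2).const_sub
      (x ^ 2))).sqrt
  simp only [sub_self, zero_mul, sqrt_zero] at h
  exact h

theorem tendsto_areaTerm_nhdsGT_zero (hx : 0 < x) (hy : 0 < y) (hz : 0 < z) (h : |y - z| < x) :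
    Tendsto (areaTerm x y z) (𝓝[>] 0) atTop := by
  have hsinh : Tendsto (fun t : ℝ => sinh (x * t)) (𝓝[>] 0) (𝓝[>] 0) := by
    refine tendsto_nhdsWithin_iff.2 ⟨?_, ?_⟩
    · have := (hasDerivAt_sinh_mul x 0).continuousAt.tendsto
      simp only [mul_zero, sinh_zero] at this
      exact this.mono_left nhdsWithin_le_nhds
    · filter_upwards [self_mem_nhdsWithin] with t ht
      exact sinh_mul_pos hx ht
  have hk : 0 < x * √(x ^ 2 - (y - z) ^ 2) := by
    refine mul_pos hx (sqrt_pos.2 (sub_pos.2 ?_))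
    rw [← sq_abs (y - z)]
    gcongr
  refine tendsto_atTop_mono' _ ?_ ((tendsto_inv_nhdsGT_zero.comp hsinh).const_mul_atTop hk)
  filter_upwards [self_mem_nhdsWithin] with t ht
  have hs := sinh_mul_pos hx ht
  rw [areaTerm, scaledCoth_sq_sub_sq hx ht, sqrt_mul (sq_nonneg _), sqrt_sq (by positivity),
    Function.comp_apply, mul_right_comm, ← div_eq_mul_inv]
  have := scaledCoth_sub_sq_le hy hz ht
  gcongr

end areaTerm


theorem exists_unique_lambda
    (a b c : ℝ) (ha : 0 < a) (hb : 0 < b) (hc : 0 < c)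
    (hta : a < b + c) (htb : b < c + a) (htc : c < a + b)
    (coth : ℝ → ℝ) (hcoth : ∀ x, coth x = Real.cosh x / Real.sinh x)
    (u v w F : ℝ → ℝ)
    (hu : ∀ lam, u lam = a * coth (a * lam / (a + b + c)))
    (hv : ∀ lam, v lam = b * coth (b * lam / (a + b + c)))
    (hw : ∀ lam, w lam = c * coth (c * lam / (a + b + c)))
    (hF : ∀ lam, F lam =
      Real.sqrt ((u lam ^ 2 - a ^ 2) * (a ^ 2 - (v lam - w lam) ^ 2))
      + Real.sqrt ((v lam ^ 2 - b ^ 2) * (b ^ 2 - (w lam - u lam) ^ 2))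
      + Real.sqrt ((w lam ^ 2 - c ^ 2) * (c ^ 2 - (u lam - v lam) ^ 2))) :
    ∃! lam : ℝ, 0 < lam ∧
      F lam = Real.sqrt (2 * (a ^ 2 * b ^ 2 + b ^ 2 * c ^ 2 + c ^ 2 * a ^ 2)
        - (a ^ 4 + b ^ 4 + c ^ 4)) := by
  set p := a + b + c with hp
  have hp0 : 0 < p := by positivity
  have ha' : |b - c| < a := abs_sub_lt_iff.2 ⟨by linarith, by linarith⟩
  have hb' : |c - a| < b := abs_sub_lt_iff.2 ⟨by linarith, by linarith⟩
  have hc' : |a - b| < c := abs_sub_lt_iff.2 ⟨by linarith, by linarith⟩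
  set G : ℝ → ℝ := fun t => areaTerm a b c t + areaTerm b c a t + areaTerm c a b t with hG
  have hFG : ∀ l, F l = G (l / p) := fun l => by
    simp only [hF, hu, hv, hw, hcoth, hG, areaTerm, scaledCoth, mul_div_assoc]
  have hanti : StrictAntiOn G (Ioi 0) :=
    ((areaTerm_strictAntiOn ha hb hc ha').add (areaTerm_strictAntiOn hb hc ha hb')).add
      (areaTerm_strictAntiOn hc ha hb hc')
  have hcont : ContinuousOn G (Ioi 0) :=
    ((continuousOn_areaTerm ha hb hc).add (continuousOn_areaTerm hb hc ha)).add
      (continuousOn_areaTerm hc ha hb)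
  have htop : Tendsto G atTop (𝓝 0) := by
    simpa only [add_zero] using ((tendsto_areaTerm_atTop ha hb hc).add
      (tendsto_areaTerm_atTop hb hc ha)).add (tendsto_areaTerm_atTop hc ha hb)
  have hzero : Tendsto G (𝓝[>] 0) atTop :=
    ((tendsto_areaTerm_nhdsGT_zero ha hb hc ha').atTop_add_atTop
      (tendsto_areaTerm_nhdsGT_zero hb hc ha hb')).atTop_add_atTop
      (tendsto_areaTerm_nhdsGT_zero hc ha hb hc')
  have hpos : 0 < √(2 * (a ^ 2 * b ^ 2 + b ^ 2 * c ^ 2 + c ^ 2 * a ^ 2)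
      - (a ^ 4 + b ^ 4 + c ^ 4)) := by
    refine sqrt_pos.2 ?_
    have heron : 2 * (a ^ 2 * b ^ 2 + b ^ 2 * c ^ 2 + c ^ 2 * a ^ 2) - (a ^ 4 + b ^ 4 + c ^ 4)
        = (a + b + c) * (b + c - a) * (c + a - b) * (a + b - c) := by ring
    rw [heron]
    exact mul_pos (mul_pos (mul_pos hp0 (sub_pos.2 hta)) (sub_pos.2 htb)) (sub_pos.2 htc)
  obtain ⟨t, ht, hGt⟩ := isPreconnected_Ioi.intermediate_value_Ioi
    (le_principal_iff.2 (Ioi_mem_atTop 0)) (le_principal_iff.2 self_mem_nhdsWithin)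
    hcont htop hzero hpos
  refine ⟨t * p, ⟨mul_pos ht hp0, ?_⟩, ?_⟩
  · rw [hFG, mul_div_cancel_right₀ _ hp0.ne', hGt]
  · rintro l ⟨hl, hFl⟩
    rw [hFG, ← hGt] at hFl
    rw [← hanti.injOn (div_pos hl hp0) ht hFl, div_mul_cancel₀ _ hp0.ne']
end
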